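/- For every integer n ≥ 9, bal(n, K_{1,3} ∪ K_2) = n−1; that is, every 2-edge-colouring of K_n with min{|R|,|B|} ≥ n contains a copy of K_{1,3} ∪ K_2 with exactly two red and two blue edges, and there is a 2-edge-colouring of K_n with min{|R|,|B|} = n−1 containing no such copy. -/

import Mathlib

/-- The set of red edges of a 2-edge-colouring of `K_n`
    (`true` = red, `false` = blue). -/
def redEdges (n : ℕ) (c : Sym2 (Fin n) → Bool) : Finset (Sym2 (Fin n)) :=
  (⊤ : SimpleGraph (Fin n)).edgeFinset.filter (fun e => c e = true)

/-- The set of blue edges of a 2-edge-colouring of `K_n`. -/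
def blueEdges (n : ℕ) (c : Sym2 (Fin n) → Bool) : Finset (Sym2 (Fin n)) :=
  (⊤ : SimpleGraph (Fin n)).edgeFinset.filter (fun e => c e = false)

/-- An `(r,b)`-coloured copy of `K_{1,3} ∪ K_2` in a 2-edge-coloured `K_n`:
six distinct vertices `v, a₁, a₂, a₃, x, y` forming the star with centre `v` and leaves
`a₁, a₂, a₃` together with the independent edge `xy`, such that exactly `r` of the four
edges are red and exactly `b` are blue. -/
def K13K2Copy (n : ℕ) (c : Sym2 (Fin n) → Bool) (r b : ℕ) : Prop :=
  ∃ v a₁ a₂ a₃ x y : Fin n, ([v, a₁, a₂, a₃, x, y] : List (Fin n)).Nodup ∧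
    ((if c s(v, a₁) = true then 1 else 0) + (if c s(v, a₂) = true then 1 else 0) +
      (if c s(v, a₃) = true then 1 else 0) + (if c s(x, y) = true then 1 else 0) = r) ∧
    ((if c s(v, a₁) = false then 1 else 0) + (if c s(v, a₂) = false then 1 else 0) +
      (if c s(v, a₃) = false then 1 else 0) + (if c s(x, y) = false then 1 else 0) = b)

/-- The graph formed by the edges of colour `k`. -/
def colourGraph {n : ℕ} (c : Sym2 (Fin n) → Bool) (k : Bool) : SimpleGraph (Fin n) where
  Adj u v := u ≠ v ∧ c s(u, v) = k
  symm := ⟨fun u v h => ⟨h.1.symm, by rw [Sym2.eq_swap]; exact h.2⟩⟩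
  loopless := ⟨fun _ h => h.1 rfl⟩

instance {n : ℕ} (c : Sym2 (Fin n) → Bool) (k : Bool) : DecidableRel (colourGraph c k).Adj :=
  fun u v => inferInstanceAs (Decidable (u ≠ v ∧ c s(u, v) = k))

theorem edgeFinset_colourGraph {n : ℕ} (c : Sym2 (Fin n) → Bool) (k : Bool) :
    (colourGraph c k).edgeFinset =
      (⊤ : SimpleGraph (Fin n)).edgeFinset.filter (fun e => c e = k) := by
  ext e
  induction e with
  | _ u v =>
    rw [SimpleGraph.mem_edgeFinset, SimpleGraph.mem_edgeSet]
    simp [colourGraph]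

/-- Two vertices outside the closed star at `v` spanned by two red and two blue neighbours
complete a balanced copy, whatever the colour of the edge between them. -/
theorem K13K2Copy_of_two_le_degree {n : ℕ} (hn : 7 ≤ n) (c : Sym2 (Fin n) → Bool) (v : Fin n)
    (hr : 2 ≤ (colourGraph c true).degree v) (hb : 2 ≤ (colourGraph c false).degree v) :
    K13K2Copy n c 2 2 := by
  obtain ⟨a₁, ha₁, a₂, ha₂, ha⟩ := Finset.one_lt_card.1 hr
  obtain ⟨b₁, hb₁, b₂, hb₂, hb⟩ := Finset.one_lt_card.1 hb
  rw [SimpleGraph.mem_neighborFinset] at ha₁ ha₂ hb₁ hb₂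
  have hab : ∀ a b, c s(v, a) = true → c s(v, b) = false → a ≠ b := by
    rintro a b h h' rfl
    simp_all
  have h₁₁ := hab _ _ ha₁.2 hb₁.2
  have h₁₂ := hab _ _ ha₁.2 hb₂.2
  have h₂₁ := hab _ _ ha₂.2 hb₁.2
  have hva₁ := ha₁.1
  have hva₂ := ha₂.1
  have hvb₁ := hb₁.1
  have hvb₂ := hb₂.1
  have hcard : 1 < (({v, a₁, a₂, b₁, b₂} : Finset (Fin n))ᶜ).card := by
    have := Finset.card_le_five (a := v) (b := a₁) (c := a₂) (d := b₁) (e := b₂)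
    rw [Finset.card_compl, Fintype.card_fin]
    omega
  obtain ⟨x, hx, y, hy, hxy⟩ := Finset.one_lt_card.1 hcard
  simp only [Finset.mem_compl, Finset.mem_insert, Finset.mem_singleton, not_or] at hx hy
  cases hc : c s(x, y)
  · refine ⟨v, a₁, a₂, b₁, x, y, ?_, ?_⟩
    · simp only [List.nodup_cons, List.mem_cons, List.not_mem_nil, List.nodup_nil]
      grind
    · simp [ha₁.2, ha₂.2, hb₁.2, hc]
  · refine ⟨v, a₁, b₁, b₂, x, y, ?_, ?_⟩
    · simp only [List.nodup_cons, List.mem_cons, List.not_mem_nil, List.nodup_nil]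
      grind
    · simp [ha₁.2, hb₁.2, hb₂.2, hc]

/-- If `G` and `H` cover the complete graph, every vertex has degree at most one in `G` or in `H`,
and at least three vertices have degree at most one in `G`, then at most one vertex has larger
degree in `G`, so `G` has fewer edges than vertices. -/
theorem card_edgeFinset_lt_of_degree_le_one {V : Type*} [Fintype V] [DecidableEq V]
    (G H : SimpleGraph V) [DecidableRel G.Adj] [DecidableRel H.Adj]
    (hGH : ∀ u v, u ≠ v → G.Adj u v ∨ H.Adj u v)
    (hdeg : ∀ v, G.degree v ≤ 1 ∨ H.degree v ≤ 1)
    (hlow : 3 ≤ (Finset.univ.filter fun v => G.degree v ≤ 1).card) :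
    G.edgeFinset.card < Fintype.card V := by
  have huniq : ∀ u v, 1 < G.degree u → 1 < G.degree v → u = v := by
    intro u v hu hv
    by_contra huv
    have hHu := (hdeg u).resolve_left (by omega)
    have hHv := (hdeg v).resolve_left (by omega)
    have hcard : (H.neighborFinset u ∪ H.neighborFinset v).card <
        (Finset.univ.filter fun v => G.degree v ≤ 1).card := by
      have := Finset.card_union_le (H.neighborFinset u) (H.neighborFinset v)
      simp only [SimpleGraph.card_neighborFinset_eq_degree] at this
      omega
    obtain ⟨w, hw, hw'⟩ := Finset.exists_mem_notMem_of_card_lt_card hcard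
    simp only [Finset.mem_filter, Finset.mem_univ, true_and] at hw
    simp only [Finset.mem_union, SimpleGraph.mem_neighborFinset, not_or] at hw'
    have hwu : u ≠ w := by rintro rfl; omega
    have hwv : v ≠ w := by rintro rfl; omega
    have hsub : ({u, v} : Finset V) ⊆ G.neighborFinset w := by
      intro z hz
      rw [SimpleGraph.mem_neighborFinset]
      rcases Finset.mem_insert.1 hz with rfl | hz
      · exact ((hGH _ _ hwu).resolve_right hw'.1).symm
      · rw [Finset.mem_singleton.1 hz]
        exact ((hGH _ _ hwv).resolve_right hw'.2).symm
    have := Finset.card_le_card hsub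
    rw [Finset.card_pair huv, SimpleGraph.card_neighborFinset_eq_degree] at this
    omega
  have hpos : 3 ≤ Fintype.card V := hlow.trans (Finset.card_le_univ _)
  have hsum := G.sum_degrees_eq_twice_card_edges
  by_cases hex : ∃ u, 1 < G.degree u
  · obtain ⟨u, hu⟩ := hex
    have hrest : ∑ v ∈ Finset.univ.erase u, G.degree v ≤ (Finset.univ.erase u).card • 1 := by
      refine Finset.sum_le_card_nsmul _ _ _ fun v hv => ?_
      by_contra! h
      exact Finset.ne_of_mem_erase hv (huniq v u h hu)
    rw [← Finset.add_sum_erase _ _ (Finset.mem_univ u)] at hsum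
    rw [Finset.card_erase_of_mem (Finset.mem_univ u), Finset.card_univ, smul_eq_mul] at hrest
    have := G.degree_lt_card_verts u
    omega
  · push Not at hex
    have hall : ∑ v, G.degree v ≤ (Finset.univ : Finset V).card • 1 :=
      Finset.sum_le_card_nsmul _ _ _ fun v _ => hex v
    rw [Finset.card_univ, smul_eq_mul] at hall
    omega

/-- A colouring with at least `n` edges of each colour has a balanced copy. -/
theorem K13K2Copy_of_le_min_card {n : ℕ} (hn : 7 ≤ n) (c : Sym2 (Fin n) → Bool)
    (hc : n ≤ min (redEdges n c).card (blueEdges n c).card) : K13K2Copy n c 2 2 := by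
  by_contra hno
  have hdeg : ∀ v, (colourGraph c true).degree v ≤ 1 ∨ (colourGraph c false).degree v ≤ 1 := by
    intro v
    by_contra! h
    exact hno (K13K2Copy_of_two_le_degree hn c v h.1 h.2)
  have hcover : ∀ u v, u ≠ v → (colourGraph c true).Adj u v ∨ (colourGraph c false).Adj u v := by
    intro u v h
    cases huv : c s(u, v)
    · exact Or.inr ⟨h, huv⟩
    · exact Or.inl ⟨h, huv⟩
  have hunion : (Finset.univ.filter fun v => (colourGraph c true).degree v ≤ 1) ∪
      (Finset.univ.filter fun v => (colourGraph c false).degree v ≤ 1) = Finset.univ := by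
    ext v
    simpa using hdeg v
  have hcard := Finset.card_union_le
    (Finset.univ.filter fun v => (colourGraph c true).degree v ≤ 1)
    (Finset.univ.filter fun v => (colourGraph c false).degree v ≤ 1)
  rw [hunion, Finset.card_univ, Fintype.card_fin] at hcard
  obtain ⟨hR, hB⟩ := le_min_iff.1 hc
  rw [redEdges, ← edgeFinset_colourGraph] at hR
  rw [blueEdges, ← edgeFinset_colourGraph] at hB
  by_cases h : 3 ≤ (Finset.univ.filter fun v => (colourGraph c true).degree v ≤ 1).card
  · have := card_edgeFinset_lt_of_degree_le_one _ _ hcover hdeg h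
    rw [Fintype.card_fin] at this
    omega
  · have := card_edgeFinset_lt_of_degree_le_one (colourGraph c false) (colourGraph c true)
      (fun u v huv => (hcover u v huv).symm) (fun v => (hdeg v).symm) (by omega)
    rw [Fintype.card_fin] at this
    omega

theorem card_redEdges_star {n : ℕ} (z : Fin n) :
    (redEdges n fun e => decide (z ∈ e)).card = n - 1 := by
  have h : (redEdges n fun e => decide (z ∈ e)) =
      (⊤ : SimpleGraph (Fin n)).incidenceFinset z := by
    simp [redEdges, SimpleGraph.incidenceFinset_eq_filter]
  rw [h, SimpleGraph.card_incidenceFinset_eq_degree, SimpleGraph.complete_graph_degree,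
    Fintype.card_fin]

theorem card_redEdges_add_card_blueEdges (n : ℕ) (c : Sym2 (Fin n) → Bool) :
    (redEdges n c).card + (blueEdges n c).card = n.choose 2 := by
  have h := Finset.card_filter_add_card_filter_not
    (s := (⊤ : SimpleGraph (Fin n)).edgeFinset) (fun e => c e = true)
  rw [SimpleGraph.card_edgeFinset_top_eq_card_choose_two, Fintype.card_fin] at h
  simpa only [redEdges, blueEdges, Bool.not_eq_true] using h

theorem not_K13K2Copy_star {n : ℕ} (z : Fin n) :
    ¬ K13K2Copy n (fun e => decide (z ∈ e)) 2 2 := by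
  rintro ⟨v, a₁, a₂, a₃, x, y, hnd, hr, -⟩
  simp only [List.nodup_cons, List.mem_cons, List.not_mem_nil, List.nodup_nil] at hnd
  simp only [decide_eq_true_eq, Sym2.mem_iff] at hr
  grind

/-- For every `n ≥ 9`, `bal(n, K_{1,3} ∪ K_2) = n - 1`: every 2-edge-colouring of `K_n`
with `min{|R|,|B|} ≥ n` contains a copy of `K_{1,3} ∪ K_2` with exactly two red and two
blue edges, and there is a 2-edge-colouring with `min{|R|,|B|} = n - 1` containing no such
copy. -/
theorem bal_K13_union_K2 (n : ℕ) (hn : 9 ≤ n) :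
    (∀ c : Sym2 (Fin n) → Bool,
        n ≤ min (redEdges n c).card (blueEdges n c).card → K13K2Copy n c 2 2) ∧
    (∃ c : Sym2 (Fin n) → Bool,
        min (redEdges n c).card (blueEdges n c).card = n - 1 ∧ ¬ K13K2Copy n c 2 2) := by
  refine ⟨fun c hc => K13K2Copy_of_le_min_card (by omega) c hc, ?_⟩
  let z : Fin n := ⟨0, by omega⟩
  refine ⟨fun e => decide (z ∈ e), ?_, not_K13K2Copy_star z⟩
  have hadd := card_redEdges_add_card_blueEdges n fun e => decide (z ∈ e)
  have hchoose : 2 * (n - 1) ≤ n.choose 2 := by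
    obtain ⟨m, rfl⟩ := Nat.exists_eq_add_of_le hn
    rw [Nat.choose_two_right, Nat.le_div_iff_mul_le (by norm_num)]
    have : 9 + m - 1 = m + 8 := by omega
    rw [this]
    nlinarith
  rw [card_redEdges_star] at hadd ⊢
  omega
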